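/- Jacobi's derivative formula: for every τ in the upper half-plane, θ₁'(0|τ) = π·ϑ₂(τ)·ϑ₃(τ)·ϑ₄(τ), where θ₁' denotes the partial derivative of θ₁(z|τ) with respect to z. -/

import Mathlib

open Complex

/-- Jacobi's θ₁. -/
noncomputable def jtheta1 (z τ : ℂ) : ℂ :=
  -I * Complex.exp ((Real.pi : ℂ) * I * τ / 4) *
    ∑' k : ℤ, (-1 : ℂ) ^ k * Complex.exp (((k : ℂ) ^ 2 + (k : ℂ)) * (Real.pi : ℂ) * I * τ)
      * Complex.exp ((2 * (k : ℂ) + 1) * (Real.pi : ℂ) * I * z)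

noncomputable def thetaC2 (τ : ℂ) : ℂ :=
  ∑' k : ℤ, Complex.exp (((k : ℂ) + 1 / 2) ^ 2 * (Real.pi : ℂ) * I * τ)

noncomputable def thetaC3 (τ : ℂ) : ℂ :=
  ∑' k : ℤ, Complex.exp ((k : ℂ) ^ 2 * (Real.pi : ℂ) * I * τ)

noncomputable def thetaC4 (τ : ℂ) : ℂ :=
  ∑' k : ℤ, (-1 : ℂ) ^ k * Complex.exp ((k : ℂ) ^ 2 * (Real.pi : ℂ) * I * τ)

open Filter Topology Finset

/-- The finite product `(1 - Q) (1 - Q ^ 2) ⋯ (1 - Q ^ n)`. -/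
noncomputable def qFactorial (Q : ℂ) (n : ℕ) : ℂ := ∏ i ∈ range n, (1 - Q ^ (i + 1))

/-- The inverse of `qFactorial`, extended by zero to the negative integers. -/
noncomputable def qFactorialInv (Q : ℂ) (m : ℤ) : ℂ :=
  if m < 0 then 0 else (qFactorial Q m.toNat)⁻¹

/-- The Gaussian binomial coefficient `2 * N` choose `N + k`. -/
noncomputable def centralQBinomial (Q : ℂ) (N : ℕ) (k : ℤ) : ℂ :=
  qFactorial Q (2 * N) * qFactorialInv Q (N + k) * qFactorialInv Q (N - k)

lemma one_sub_pow_succ_ne_zero {Q : ℂ} (hQ : ‖Q‖ < 1) (n : ℕ) : 1 - Q ^ (n + 1) ≠ 0 := by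
  intro h
  have h1 : ‖Q ^ (n + 1)‖ = 1 := by rw [← sub_eq_zero.mp h, norm_one]
  rw [norm_pow] at h1
  exact (pow_lt_one₀ (norm_nonneg Q) hQ n.succ_ne_zero).ne h1

lemma qFactorial_succ (Q : ℂ) (n : ℕ) :
    qFactorial Q (n + 1) = qFactorial Q n * (1 - Q ^ (n + 1)) :=
  prod_range_succ _ _

lemma qFactorial_ne_zero {Q : ℂ} (hQ : ‖Q‖ < 1) (n : ℕ) : qFactorial Q n ≠ 0 :=
  prod_ne_zero_iff.mpr fun i _ => one_sub_pow_succ_ne_zero hQ i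

lemma exists_tendsto_qFactorial {Q : ℂ} (hQ : ‖Q‖ < 1) :
    ∃ A : ℂ, A ≠ 0 ∧ Tendsto (qFactorial Q) atTop (𝓝 A) := by
  refine ⟨∏' n : ℕ, (1 - Q ^ (n + 1)), ?_,
    (ModularForm.multipliable_one_sub_pow hQ).hasProd.tendsto_prod_nat⟩
  simp only [sub_eq_add_neg]
  refine tprod_one_add_ne_zero_of_summable
    (fun i => by simpa [← sub_eq_add_neg] using one_sub_pow_succ_ne_zero hQ i) ?_
  simpa using (summable_nat_add_iff 1).mpr (summable_geometric_of_lt_one (norm_nonneg _) hQ)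

lemma qFactorialInv_sub_one {Q : ℂ} (hQ : ‖Q‖ < 1) (m : ℤ) :
    qFactorialInv Q (m - 1) = (1 - Q ^ m) * qFactorialInv Q m := by
  rcases lt_trichotomy m 0 with hm | rfl | hm
  · simp [qFactorialInv, hm, show m < 1 by lia]
  · simp [qFactorialInv]
  · obtain ⟨n, rfl⟩ : ∃ n : ℕ, m = n + 1 := ⟨(m - 1).toNat, by lia⟩
    have h := one_sub_pow_succ_ne_zero hQ n
    have h' := qFactorial_ne_zero hQ n
    rw [qFactorialInv, qFactorialInv, if_neg (by lia), if_neg (by lia),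
      show ((n : ℤ) + 1 - 1).toNat = n by lia, show ((n : ℤ) + 1).toNat = n + 1 by lia,
      qFactorial_succ, show Q ^ ((n : ℤ) + 1) = Q ^ (n + 1) by exact_mod_cast zpow_natCast Q (n + 1)]
    field_simp

lemma tendsto_qFactorialInv {Q A : ℂ} (hA : A ≠ 0) (h : Tendsto (qFactorial Q) atTop (𝓝 A)) :
    Tendsto (qFactorialInv Q) atTop (𝓝 A⁻¹) := by
  have hn : Tendsto Int.toNat atTop atTop :=
    tendsto_atTop.mpr fun b => (eventually_ge_atTop (b : ℤ)).mono fun m hm => by lia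
  refine ((h.inv₀ hA).comp hn).congr' ?_
  filter_upwards [eventually_ge_atTop 0] with m hm
  simp [qFactorialInv, not_lt.mpr hm]

lemma tendsto_centralQBinomial {Q A : ℂ} (hA : A ≠ 0)
    (h : Tendsto (qFactorial Q) atTop (𝓝 A)) (k : ℤ) :
    Tendsto (centralQBinomial Q · k) atTop (𝓝 A⁻¹) := by
  have h2 : Tendsto (fun N : ℕ => 2 * N) atTop atTop :=
    tendsto_id.const_mul_atTop' two_pos
  have hp : Tendsto (fun N : ℕ => (N : ℤ) + k) atTop atTop :=
    tendsto_atTop_add_const_right _ _ tendsto_natCast_atTop_atTop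
  have hm : Tendsto (fun N : ℕ => (N : ℤ) - k) atTop atTop :=
    tendsto_atTop_add_const_right _ (-k) tendsto_natCast_atTop_atTop
  have hr := tendsto_qFactorialInv hA h
  have := ((h.comp h2).mul (hr.comp hp)).mul (hr.comp hm)
  rwa [mul_inv_cancel₀ hA, one_mul] at this

lemma exists_norm_centralQBinomial_le {Q A : ℂ} (hA : A ≠ 0)
    (h : Tendsto (qFactorial Q) atTop (𝓝 A)) :
    ∃ C : ℝ, ∀ N k, ‖centralQBinomial Q N k‖ ≤ C := by
  obtain ⟨C, hC⟩ := (Metric.isBounded_range_of_tendsto _ h).exists_norm_le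
  obtain ⟨D, hD⟩ := (Metric.isBounded_range_of_tendsto _ (h.inv₀ hA)).exists_norm_le
  have hC' (n) : ‖qFactorial Q n‖ ≤ C := hC _ ⟨n, rfl⟩
  have hC0 : 0 ≤ C := (norm_nonneg _).trans (hC' 0)
  have hD0 : 0 ≤ D := (norm_nonneg _).trans (hD _ ⟨0, rfl⟩)
  have hD' (m : ℤ) : ‖qFactorialInv Q m‖ ≤ D := by
    unfold qFactorialInv
    split_ifs
    · simpa using hD0
    · exact hD _ ⟨m.toNat, rfl⟩
  refine ⟨C * D * D, fun N k => ?_⟩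
  rw [centralQBinomial, norm_mul, norm_mul]
  gcongr
  exacts [hC' _, hD' _, hD' _]

lemma tendsto_tsum_centralQBinomial_mul {Q A : ℂ} (hA : A ≠ 0)
    (h : Tendsto (qFactorial Q) atTop (𝓝 A)) {b : ℤ → ℂ} (hb : Summable b) :
    Tendsto (fun N => ∑' k, centralQBinomial Q N k * b k) atTop (𝓝 (A⁻¹ * ∑' k, b k)) := by
  obtain ⟨C, hC⟩ := exists_norm_centralQBinomial_le hA h
  rw [← tsum_mul_left]
  refine tendsto_tsum_of_dominated_convergence (hb.norm.mul_left C)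
    (fun k => (tendsto_centralQBinomial hA h k).mul_const _) (.of_forall fun N k => ?_)
  rw [norm_mul]
  gcongr
  exact hC N k

lemma centralQBinomial_zero (Q : ℂ) (k : ℤ) : centralQBinomial Q 0 k = if k = 0 then 1 else 0 := by
  rcases lt_trichotomy k 0 with hk | rfl | hk
  · simp [centralQBinomial, qFactorialInv, hk, hk.ne]
  · simp [centralQBinomial, qFactorialInv, qFactorial]
  · simp [centralQBinomial, qFactorialInv, hk, hk.ne']

lemma centralQBinomial_succ_mul {q : ℂ} (hq : ‖q‖ < 1) (hq0 : q ≠ 0) (N : ℕ) (k : ℤ) :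
    centralQBinomial (q ^ 2) (N + 1) k * q ^ (k ^ 2) =
      (1 + (q ^ (2 * N + 1)) ^ 2) * (centralQBinomial (q ^ 2) N k * q ^ (k ^ 2)) +
      q ^ (2 * N + 1) * (centralQBinomial (q ^ 2) N (k - 1) * q ^ ((k - 1) ^ 2)) +
      q ^ (2 * N + 1) * (centralQBinomial (q ^ 2) N (k + 1) * q ^ ((k + 1) ^ 2)) := by
  have hQ : ‖q ^ 2‖ < 1 := by rw [norm_pow]; exact pow_lt_one₀ (norm_nonneg q) hq two_ne_zero
  have hr := qFactorialInv_sub_one hQ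
  have e1 : qFactorialInv (q ^ 2) (N + k) =
      (1 - (q ^ 2) ^ ((N : ℤ) + 1 + k)) * qFactorialInv (q ^ 2) (N + 1 + k) := by
    rw [show (N : ℤ) + k = (N + 1 + k) - 1 by ring, hr]
  have e2 : qFactorialInv (q ^ 2) (N + (k - 1)) =
      (1 - (q ^ 2) ^ ((N : ℤ) + k)) * qFactorialInv (q ^ 2) (N + k) := by
    rw [show (N : ℤ) + (k - 1) = (N + k) - 1 by ring, hr]
  have e3 : qFactorialInv (q ^ 2) (N - k) =
      (1 - (q ^ 2) ^ ((N : ℤ) + 1 - k)) * qFactorialInv (q ^ 2) (N + 1 - k) := by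
    rw [show (N : ℤ) - k = (N + 1 - k) - 1 by ring, hr]
  have e4 : qFactorialInv (q ^ 2) (N - (k + 1)) =
      (1 - (q ^ 2) ^ ((N : ℤ) - k)) * qFactorialInv (q ^ 2) (N - k) := by
    rw [show (N : ℤ) - (k + 1) = (N - k) - 1 by ring, hr]
  simp only [centralQBinomial, e1, e2, e3, e4, show 2 * (N + 1) = 2 * N + 1 + 1 by ring,
    qFactorial_succ, Nat.cast_add, Nat.cast_one, show (N : ℤ) - (k - 1) = N + 1 - k by ring,
    show (N : ℤ) + (k + 1) = N + 1 + k by ring]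
  generalize qFactorialInv (q ^ 2) (N + 1 + k) = R
  generalize qFactorialInv (q ^ 2) (N + 1 - k) = S
  generalize qFactorial (q ^ 2) (2 * N) = F
  have hQ0 : q ^ 2 ≠ 0 := pow_ne_zero 2 hq0
  simp only [show (k - 1) ^ 2 = k ^ 2 - k - k + 1 by ring,
    show (k + 1) ^ 2 = k ^ 2 + k + k + 1 by ring, zpow_add₀ hq0, zpow_sub₀ hq0, zpow_add₀ hQ0,
    zpow_sub₀ hQ0, zpow_natCast, zpow_one, pow_add, pow_mul, pow_one]
  have ek : (q ^ 2) ^ k = q ^ k * q ^ k := by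
    rw [pow_two, mul_zpow]
  rw [ek]
  have hx : q ^ k ≠ 0 := zpow_ne_zero k hq0
  generalize q ^ k = x at *
  generalize q ^ k ^ 2 = y
  rw [← pow_mul, ← pow_mul, mul_comm 2 N, pow_mul]
  generalize q ^ N = z
  field_simp
  ring

/-- The finite form of the Jacobi triple product. -/
lemma hasSum_centralQBinomial_mul_zpow {q w : ℂ} (hq : ‖q‖ < 1) (hq0 : q ≠ 0) (hw : w ≠ 0)
    (N : ℕ) :
    HasSum (fun k : ℤ => centralQBinomial (q ^ 2) N k * (q ^ (k ^ 2) * w ^ k))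
      (∏ m ∈ range N, (1 + q ^ (2 * m + 1) * w) * (1 + q ^ (2 * m + 1) / w)) := by
  induction N with
  | zero =>
    convert hasSum_ite_eq (0 : ℤ) (1 : ℂ) using 2 with k
    · rw [centralQBinomial_zero]
      split_ifs with hk <;> simp [hk]
    · simp
  | succ N ih =>
    have hp := (Equiv.subRight (1 : ℤ)).hasSum_iff.mpr ih
    have hm := (Equiv.addRight (1 : ℤ)).hasSum_iff.mpr ih
    rw [prod_range_succ]
    convert ((ih.mul_left (1 + (q ^ (2 * N + 1)) ^ 2)).add
      (hp.mul_left (q ^ (2 * N + 1) * w))).add (hm.mul_left (q ^ (2 * N + 1) / w)) using 1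
    · rfl
    · funext k
      simp only [Function.comp_apply, Equiv.subRight_apply, Equiv.coe_addRight, ← mul_assoc]
      rw [centralQBinomial_succ_mul hq hq0, zpow_add_one₀ hw, zpow_sub_one₀ hw]
      field_simp
    · generalize ∏ m ∈ range N, (1 + q ^ (2 * m + 1) * w) * (1 + q ^ (2 * m + 1) / w) = P
      field_simp
      ring

/-- The logarithmic derivative in `w` of the finite triple product, at its zero `w = -q`. -/
lemma hasSum_intCast_mul_centralQBinomial {q : ℂ} (hq : ‖q‖ < 1) (hq0 : q ≠ 0) (N : ℕ) :
    HasSum (fun k : ℤ => centralQBinomial (q ^ 2) (N + 1) k * (k * (q ^ (k ^ 2) * (-q) ^ k)))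
      (qFactorial (q ^ 2) (N + 1) * qFactorial (q ^ 2) N) := by
  have hw : -q ≠ 0 := neg_ne_zero.mpr hq0
  have step (M : ℕ) {s t : ℂ}
      (h0 : HasSum (fun k : ℤ => centralQBinomial (q ^ 2) M k * (q ^ (k ^ 2) * (-q) ^ k)) t)
      (h1 : HasSum (fun k : ℤ => centralQBinomial (q ^ 2) M k * (k * (q ^ (k ^ 2) * (-q) ^ k))) s) :
      HasSum (fun k : ℤ =>
        centralQBinomial (q ^ 2) (M + 1) k * (k * (q ^ (k ^ 2) * (-q) ^ k)))
        ((1 - q ^ (2 * M + 2)) * (1 - q ^ (2 * M)) * s + (q ^ (2 * M) - q ^ (2 * M + 2)) * t) := by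
    have hp := (Equiv.subRight (1 : ℤ)).hasSum_iff.mpr (h1.add h0)
    have hm := (Equiv.addRight (1 : ℤ)).hasSum_iff.mpr (h1.sub h0)
    convert ((h1.mul_left (1 + (q ^ (2 * M + 1)) ^ 2)).add
      (hp.mul_left (-q ^ (2 * M + 2)))).add (hm.mul_left (-q ^ (2 * M))) using 1
    · rfl
    · funext k
      simp only [Function.comp_apply, Equiv.subRight_apply, Equiv.coe_addRight]
      have := centralQBinomial_succ_mul hq hq0 M k
      rw [show centralQBinomial (q ^ 2) (M + 1) k * (k * (q ^ k ^ 2 * (-q) ^ k)) =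
        (centralQBinomial (q ^ 2) (M + 1) k * q ^ k ^ 2) * (k * (-q) ^ k) by ring, this,
        zpow_add_one₀ hw, zpow_sub_one₀ hw]
      push_cast
      field_simp
      ring
    · ring
  induction N with
  | zero =>
    have h0 := hasSum_centralQBinomial_mul_zpow hq hq0 hw 0
    have h1 : HasSum (fun k : ℤ =>
        centralQBinomial (q ^ 2) 0 k * (k * (q ^ (k ^ 2) * (-q) ^ k))) 0 := by
      convert hasSum_zero using 2 with k
      rw [centralQBinomial_zero]
      split_ifs with hk <;> simp [hk]
    convert step 0 h0 h1 using 1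
    simp [qFactorial]
  | succ N ih =>
    have h0 := hasSum_centralQBinomial_mul_zpow hq hq0 hw (N + 1)
    rw [prod_range_succ', show 1 + q ^ (2 * 0 + 1) / -q = 0 by simp [hq0], mul_zero,
      mul_zero] at h0
    convert step (N + 1) h0 ih using 1
    rw [qFactorial_succ _ (N + 1)]
    nth_rewrite 2 [qFactorial_succ _ N]
    simp only [← pow_mul]
    ring_nf

lemma prod_one_sub_odd_pow_mul_one_add_pow (Q : ℂ) (N : ℕ) :
    (∏ m ∈ range N, (1 - Q ^ (2 * m + 1)) * (1 + Q ^ (m + 1))) * qFactorial Q N =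
      qFactorial Q (2 * N) := by
  induction N with
  | zero => simp [qFactorial]
  | succ N ih =>
    rw [prod_range_succ, qFactorial_succ, show 2 * (N + 1) = 2 * N + 1 + 1 by ring,
      qFactorial_succ, qFactorial_succ, ← ih]
    ring

/-- Euler's identity `∏ (1 - Q ^ (2 * m + 1)) * (1 + Q ^ (m + 1)) = 1`. -/
lemma tendsto_prod_one_sub_odd_pow_mul_one_add_pow {Q : ℂ} (hQ : ‖Q‖ < 1) :
    Tendsto (fun N => ∏ m ∈ range N, (1 - Q ^ (2 * m + 1)) * (1 + Q ^ (m + 1))) atTop (𝓝 1) := by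
  obtain ⟨A, hA, h⟩ := exists_tendsto_qFactorial hQ
  have h2 : Tendsto (fun N : ℕ => 2 * N) atTop atTop :=
    tendsto_id.const_mul_atTop' two_pos
  have := (h.comp h2).div h hA
  rw [div_self hA] at this
  refine this.congr fun N => ?_
  simp [← prod_one_sub_odd_pow_mul_one_add_pow, qFactorial_ne_zero hQ N]

lemma jacobiTheta₂_term_eq_zpow {w z : ℂ} (τ : ℂ) (hz : exp (2 * Real.pi * I * z) = w) (k : ℤ) :
    jacobiTheta₂_term k z τ = exp (Real.pi * I * τ) ^ (k ^ 2) * w ^ k := by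
  rw [jacobiTheta₂_term, ← hz, ← exp_int_mul, ← exp_int_mul, ← exp_add]
  push_cast
  ring_nf

lemma exists_exp_two_pi_mul_I_mul_eq {w : ℂ} (hw : w ≠ 0) :
    ∃ z : ℂ, exp (2 * Real.pi * I * z) = w :=
  ⟨log w / (2 * Real.pi * I), by rw [mul_div_cancel₀ _ two_pi_I_ne_zero, exp_log hw]⟩

lemma summable_zpow_sq_mul_zpow {τ w : ℂ} (hτ : 0 < τ.im) (hw : w ≠ 0) :
    Summable fun k : ℤ => exp (Real.pi * I * τ) ^ (k ^ 2) * w ^ k := by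
  obtain ⟨z, hz⟩ := exists_exp_two_pi_mul_I_mul_eq hw
  simpa only [jacobiTheta₂_term_eq_zpow τ hz] using (summable_jacobiTheta₂_term_iff z τ).mpr hτ

lemma summable_intCast_mul_zpow_sq_mul_zpow {τ w : ℂ} (hτ : 0 < τ.im) (hw : w ≠ 0) :
    Summable fun k : ℤ => (k : ℂ) * (exp (Real.pi * I * τ) ^ (k ^ 2) * w ^ k) := by
  obtain ⟨z, hz⟩ := exists_exp_two_pi_mul_I_mul_eq hw
  have h := (summable_jacobiTheta₂'_term_iff z τ).mpr hτ
  simp only [jacobiTheta₂'_term, jacobiTheta₂_term_eq_zpow τ hz, mul_assoc (2 * Real.pi * I)] at h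
  exact (summable_mul_left_iff two_pi_I_ne_zero).mp h

lemma norm_exp_pi_mul_I_mul_lt_one {τ : ℂ} (hτ : 0 < τ.im) : ‖exp (Real.pi * I * τ)‖ < 1 := by
  rw [norm_exp, Real.exp_lt_one_iff]
  simpa using mul_pos Real.pi_pos hτ

/-- The Jacobi triple product, with the products taken as limits of finite products. -/
lemma tendsto_prod_jacobi_triple {τ w A : ℂ} (hτ : 0 < τ.im) (hw : w ≠ 0) (hA : A ≠ 0)
    (h : Tendsto (qFactorial (exp (Real.pi * I * τ) ^ 2)) atTop (𝓝 A)) :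
    Tendsto (fun N => ∏ m ∈ range N, (1 + exp (Real.pi * I * τ) ^ (2 * m + 1) * w) *
      (1 + exp (Real.pi * I * τ) ^ (2 * m + 1) / w)) atTop
      (𝓝 (A⁻¹ * ∑' k : ℤ, exp (Real.pi * I * τ) ^ (k ^ 2) * w ^ k)) := by
  have := tendsto_tsum_centralQBinomial_mul hA h (summable_zpow_sq_mul_zpow hτ hw)
  simpa only [(hasSum_centralQBinomial_mul_zpow (norm_exp_pi_mul_I_mul_lt_one hτ)
    (exp_ne_zero _) hw _).tsum_eq] using this

lemma tsum_zpow_sq_mul_neg_zpow {τ : ℂ} (hτ : 0 < τ.im) :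
    ∑' k : ℤ, exp (Real.pi * I * τ) ^ (k ^ 2) * (-exp (Real.pi * I * τ)) ^ k = 0 := by
  have hq := norm_exp_pi_mul_I_mul_lt_one hτ
  have hq0 := exp_ne_zero (Real.pi * I * τ)
  obtain ⟨A, hA, h⟩ := exists_tendsto_qFactorial (Q := exp (Real.pi * I * τ) ^ 2)
    (by rw [norm_pow]; exact pow_lt_one₀ (norm_nonneg _) hq two_ne_zero)
  have h1 := (tendsto_prod_jacobi_triple hτ (neg_ne_zero.mpr hq0) hA h).comp (tendsto_add_atTop_nat 1)
  have h2 := tendsto_nhds_unique (h1.congr' (f₂ := fun _ => 0) (.of_forall fun N => by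
    simp [prod_range_succ', div_neg])) tendsto_const_nhds
  simpa [hA] using h2

lemma tsum_intCast_mul_zpow_sq_mul_neg_zpow {τ A : ℂ} (hτ : 0 < τ.im) (hA : A ≠ 0)
    (h : Tendsto (qFactorial (exp (Real.pi * I * τ) ^ 2)) atTop (𝓝 A)) :
    ∑' k : ℤ, (k : ℂ) * (exp (Real.pi * I * τ) ^ (k ^ 2) * (-exp (Real.pi * I * τ)) ^ k) =
      A ^ 3 := by
  have hq := norm_exp_pi_mul_I_mul_lt_one hτ
  have hq0 := exp_ne_zero (Real.pi * I * τ)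
  have h1 := (tendsto_tsum_centralQBinomial_mul hA h
    (summable_intCast_mul_zpow_sq_mul_zpow hτ (neg_ne_zero.mpr hq0))).comp (tendsto_add_atTop_nat 1)
  have h2 := tendsto_nhds_unique (h1.congr fun N =>
    (hasSum_intCast_mul_centralQBinomial hq hq0 N).tsum_eq)
    ((h.comp (tendsto_add_atTop_nat 1)).mul h)
  rw [inv_mul_eq_iff_eq_mul₀ hA] at h2
  rw [h2]
  ring

/-- The product of the three even theta constants, up to the factor `exp (π * I * τ / 4)`. -/
lemma tsum_mul_tsum_mul_tsum_zpow_sq {τ A : ℂ} (hτ : 0 < τ.im) (hA : A ≠ 0)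
    (h : Tendsto (qFactorial (exp (Real.pi * I * τ) ^ 2)) atTop (𝓝 A)) :
    (∑' k : ℤ, exp (Real.pi * I * τ) ^ (k ^ 2) * exp (Real.pi * I * τ) ^ k) *
      (∑' k : ℤ, exp (Real.pi * I * τ) ^ (k ^ 2) * 1 ^ k) *
      (∑' k : ℤ, exp (Real.pi * I * τ) ^ (k ^ 2) * (-1) ^ k) = 2 * A ^ 3 := by
  have hq := norm_exp_pi_mul_I_mul_lt_one hτ
  have hq0 := exp_ne_zero (Real.pi * I * τ)
  have hQ : ‖exp (Real.pi * I * τ) ^ 2‖ < 1 := by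
    rw [norm_pow]; exact pow_lt_one₀ (norm_nonneg _) hq two_ne_zero
  have h1 := ((tendsto_prod_jacobi_triple hτ hq0 hA h).mul
    (tendsto_prod_jacobi_triple hτ one_ne_zero hA h)).mul
    (tendsto_prod_jacobi_triple hτ (neg_ne_zero.mpr one_ne_zero) hA h)
  have h1' := h1.mul ((tendsto_pow_atTop_nhds_zero_of_norm_lt_one hQ).const_add 1)
  have h2 := ((tendsto_prod_one_sub_odd_pow_mul_one_add_pow hQ).pow 2).const_mul 2
  have h3 := tendsto_nhds_unique (h1'.congr fun N => ?_) h2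
  · field_simp at h3
    linear_combination h3
  · generalize exp (Real.pi * I * τ) = q at hq0
    induction N with
    | zero => norm_num
    | succ N ih =>
      simp only [prod_range_succ, mul_pow] at ih ⊢
      have e : q ^ (2 * N + 1) / q = (q ^ 2) ^ N := by
        rw [← pow_mul, pow_succ, mul_div_cancel_right₀ _ hq0]
      rw [e]
      simp only [div_one, div_neg, mul_one, mul_neg] at ih ⊢
      linear_combination (1 + q ^ (2 * N + 1) * q) * (1 + q ^ (2 * N + 1)) ^ 2 *
        (1 - q ^ (2 * N + 1)) ^ 2 * (1 + (q ^ 2) ^ (N + 1)) * ih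

lemma thetaC2_eq (τ : ℂ) : thetaC2 τ = exp (Real.pi * I * τ / 4) *
    ∑' k : ℤ, exp (Real.pi * I * τ) ^ (k ^ 2) * exp (Real.pi * I * τ) ^ k := by
  rw [thetaC2, ← tsum_mul_left]
  refine tsum_congr fun k => ?_
  rw [← exp_int_mul, ← exp_int_mul, ← exp_add, ← exp_add]
  push_cast
  ring_nf

lemma thetaC3_eq (τ : ℂ) : thetaC3 τ = ∑' k : ℤ, exp (Real.pi * I * τ) ^ (k ^ 2) * 1 ^ k := by
  refine tsum_congr fun k => ?_
  rw [one_zpow, mul_one, ← exp_int_mul]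
  push_cast
  ring_nf

lemma thetaC4_eq (τ : ℂ) : thetaC4 τ = ∑' k : ℤ, exp (Real.pi * I * τ) ^ (k ^ 2) * (-1) ^ k := by
  refine tsum_congr fun k => ?_
  rw [mul_comm, ← exp_int_mul]
  push_cast
  ring_nf

lemma exp_two_pi_mul_I_mul_half (τ : ℂ) :
    exp (2 * Real.pi * I * (τ / 2 + 1 / 2)) = -exp (Real.pi * I * τ) := by
  rw [show 2 * Real.pi * I * (τ / 2 + 1 / 2) = Real.pi * I * τ + Real.pi * I by ring, exp_add,
    exp_pi_mul_I, mul_neg_one]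

lemma jtheta1_eq_jacobiTheta₂ (z τ : ℂ) : jtheta1 z τ =
    -I * exp (Real.pi * I * τ / 4) *
      (exp (Real.pi * I * z) * jacobiTheta₂ (z + (τ / 2 + 1 / 2)) τ) := by
  rw [jtheta1, jacobiTheta₂, ← tsum_mul_left (a := exp (Real.pi * I * z))]
  congr 1
  refine tsum_congr fun k => ?_
  rw [← exp_pi_mul_I, ← exp_int_mul, jacobiTheta₂_term, ← exp_add, ← exp_add, ← exp_add]
  ring_nf

/-- Jacobi's derivative formula θ₁'(0|τ) = π ϑ₂ ϑ₃ ϑ₄. -/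
theorem jacobi_derivative_formula (τ : ℂ) (hτ : 0 < τ.im) :
    HasDerivAt (fun z : ℂ => jtheta1 z τ)
      ((Real.pi : ℂ) * thetaC2 τ * thetaC3 τ * thetaC4 τ) 0 := by
  obtain ⟨A, hA, h⟩ := exists_tendsto_qFactorial (Q := exp (Real.pi * I * τ) ^ 2) (by
    rw [norm_pow]
    exact pow_lt_one₀ (norm_nonneg _) (norm_exp_pi_mul_I_mul_lt_one hτ) two_ne_zero)
  have hz := exp_two_pi_mul_I_mul_half τ
  have hθ : jacobiTheta₂ (0 + (τ / 2 + 1 / 2)) τ = 0 := by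
    simp only [zero_add, jacobiTheta₂, jacobiTheta₂_term_eq_zpow τ hz, tsum_zpow_sq_mul_neg_zpow hτ]
  have hθ' : jacobiTheta₂' (0 + (τ / 2 + 1 / 2)) τ = 2 * Real.pi * I * A ^ 3 := by
    simp only [zero_add, jacobiTheta₂', jacobiTheta₂'_term, jacobiTheta₂_term_eq_zpow τ hz,
      mul_assoc (2 * Real.pi * I), tsum_mul_left, tsum_intCast_mul_zpow_sq_mul_neg_zpow hτ hA h]
  have hexp : HasDerivAt (fun z : ℂ => exp (Real.pi * I * z)) (Real.pi * I) 0 := by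
    simpa using ((hasDerivAt_id (0 : ℂ)).const_mul (Real.pi * I : ℂ)).cexp
  have hd := (hexp.mul ((hasDerivAt_jacobiTheta₂_fst (0 + (τ / 2 + 1 / 2)) hτ).comp_add_const
    0 (τ / 2 + 1 / 2))).const_mul (-I * exp (Real.pi * I * τ / 4))
  simp only [jtheta1_eq_jacobiTheta₂]
  refine hd.congr_deriv ?_
  rw [hθ, hθ', thetaC2_eq, thetaC3_eq, thetaC4_eq]
  have key := tsum_mul_tsum_mul_tsum_zpow_sq hτ hA h
  simp only [mul_zero, exp_zero, zero_add]
  linear_combination -Real.pi * exp (Real.pi * I * τ / 4) * key -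
    2 * Real.pi * exp (Real.pi * I * τ / 4) * A ^ 3 * I_sq
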